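/- arXiv:2111.01211 — 4 statements merged into one kernel-verified Lean document; each statement's English description precedes it below -/
import Mathlib

section
/- Let ι be a finite type with decidable equality, m : ℕ, and let i j : Fin m → ι and θ : Fin m → ℝ be such that the 2m values i 0, …, i (m−1), j 0, …, j (m−1) are pairwise distinct. Then the product ∏ l : Fin m, R⁺(i l, j l, θ l) equals the matrix M : Matrix ι ι ℂ defined by: for each l, M (i l) (i l) = M (j l) (j l) = cos(θ l / 2), M (i l) (j l) = −sin(θ l / 2), M (j l) (i l) = sin(θ l / 2); M a a = 1 for every a not in the range of i nor in the range of j; and all other entries 0. In particular the factors commute and the product simultaneously rotates the m disjoint two-dimensional coordinate subspaces. -/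
open Matrix

/-- The two-level rotation matrix `R⁺(i, j, θ)`: it acts as the 2×2 rotation by `θ/2`
on the coordinates `i, j` and as the identity elsewhere. -/
noncomputable def Rplus {ι : Type*} [DecidableEq ι] (i j : ι) (θ : ℝ) : Matrix ι ι ℂ :=
  Matrix.of fun a b =>
    if a = i then
      (if b = i then (Real.cos (θ / 2) : ℂ) else if b = j then (-(Real.sin (θ / 2)) : ℂ) else 0)
    else if a = j then
      (if b = i then (Real.sin (θ / 2) : ℂ) else if b = j then (Real.cos (θ / 2) : ℂ) else 0)
    else (if a = b then 1 else 0)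

/-- The one-level phase matrix `P⁺(i, θ)`. -/
noncomputable def Pplus {ι : Type*} [DecidableEq ι] (i : ι) (θ : ℝ) : Matrix ι ι ℂ :=
  Matrix.diagonal (fun a => if a = i then Complex.exp ((θ : ℂ) * Complex.I) else 1)

/-- The permutation matrix of `σ`, mapping `e_b` to `e_{σ b}`. -/
def permMat {ι : Type*} [DecidableEq ι] (σ : Equiv.Perm ι) : Matrix ι ι ℂ :=
  Matrix.of fun a b => if a = σ b then 1 else 0

theorem Rplus_apply_of_ne {ι : Type*} [DecidableEq ι] {i j a : ι} (θ : ℝ)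
    (hi : a ≠ i) (hj : a ≠ j) (b : ι) : Rplus i j θ a b = (1 : Matrix ι ι ℂ) a b := by
  simp [Rplus, hi, hj, Matrix.one_apply]

theorem Rplus_apply_eq_zero {ι : Type*} [DecidableEq ι] {i j a c : ι} (θ : ℝ)
    (ha : a = i ∨ a = j) (hi : c ≠ i) (hj : c ≠ j) : Rplus i j θ a c = 0 := by
  rcases ha with rfl | rfl <;> simp [Rplus, hi, hj]

/-- Left multiplication by `Rplus i j θ` leaves all rows other than `i` and `j` unchanged. -/
theorem Rplus_mul_apply_of_ne {ι : Type*} [Fintype ι] [DecidableEq ι] {i j a : ι} (θ : ℝ)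
    (Q : Matrix ι ι ℂ) (hi : a ≠ i) (hj : a ≠ j) (b : ι) : (Rplus i j θ * Q) a b = Q a b := by
  simp only [Matrix.mul_apply, Rplus_apply_of_ne θ hi hj]
  rw [← Matrix.mul_apply, one_mul]

/-- If the rows `i` and `j` of `Q` agree with those of the identity, then the rows `i` and `j` of
`Rplus i j θ * Q` agree with those of `Rplus i j θ`. -/
theorem Rplus_mul_apply_of_rows_eq_one {ι : Type*} [Fintype ι] [DecidableEq ι] {i j a b : ι}
    (θ : ℝ) (Q : Matrix ι ι ℂ) (hQ : ∀ c, c = i ∨ c = j → Q c b = (1 : Matrix ι ι ℂ) c b)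
    (ha : a = i ∨ a = j) : (Rplus i j θ * Q) a b = Rplus i j θ a b := by
  conv_rhs => rw [← mul_one (Rplus i j θ)]
  simp only [Matrix.mul_apply]
  refine Finset.sum_congr rfl fun c _ => ?_
  by_cases hc : c = i ∨ c = j
  · rw [hQ c hc]
  · rw [not_or] at hc
    simp [Rplus_apply_eq_zero θ ha hc.1 hc.2]

theorem list_prod_Rplus_apply_of_ne {ι κ : Type*} [Fintype ι] [DecidableEq ι]
    (i j : κ → ι) (θ : κ → ℝ) (L : List κ) {a : ι} (h : ∀ l ∈ L, a ≠ i l ∧ a ≠ j l) (b : ι) :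
    (L.map fun l => Rplus (i l) (j l) (θ l)).prod a b = (1 : Matrix ι ι ℂ) a b := by
  induction L with
  | nil => simp
  | cons k L ih =>
    rw [List.forall_mem_cons] at h
    rw [List.map_cons, List.prod_cons, Rplus_mul_apply_of_ne _ _ h.1.1 h.1.2, ih h.2]

theorem list_prod_Rplus_apply_of_mem {ι κ : Type*} [Fintype ι] [DecidableEq ι]
    (i j : κ → ι) (θ : κ → ℝ)
    (hdisj : ∀ k l, k ≠ l → ∀ a, a = i k ∨ a = j k → a ≠ i l ∧ a ≠ j l)
    {L : List κ} (hL : L.Nodup) {l : κ} (hl : l ∈ L) {a : ι} (ha : a = i l ∨ a = j l) (b : ι) :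
    (L.map fun l => Rplus (i l) (j l) (θ l)).prod a b = Rplus (i l) (j l) (θ l) a b := by
  induction L with
  | nil => simp at hl
  | cons k L ih =>
    rw [List.nodup_cons] at hL
    rw [List.map_cons, List.prod_cons]
    rcases List.mem_cons.1 hl with rfl | hl
    · refine Rplus_mul_apply_of_rows_eq_one _ _ (fun c hc => ?_) ha
      exact list_prod_Rplus_apply_of_ne i j θ L
        (fun k hk => hdisj l k (fun h => hL.1 (h ▸ hk)) c hc) b
    · have hne := hdisj l k (fun h => hL.1 (h ▸ hl)) a ha
      rw [Rplus_mul_apply_of_ne _ _ hne.1 hne.2, ih hL.2 hl]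

/-- A product of two-level rotations on pairwise disjoint index pairs equals the matrix
that simultaneously rotates the disjoint two-dimensional coordinate subspaces, is the
identity on the remaining coordinates, and is zero elsewhere. -/
theorem prod_Rplus_disjoint {ι : Type*} [Fintype ι] [DecidableEq ι] (m : ℕ)
    (i j : Fin m → ι) (θ : Fin m → ℝ)
    (hinj : Function.Injective (Sum.elim i j : Fin m ⊕ Fin m → ι))
    (P : Matrix ι ι ℂ)
    (hP : P = ((List.finRange m).map (fun l => Rplus (i l) (j l) (θ l))).prod) :
    (∀ l : Fin m,
        P (i l) (i l) = (Real.cos (θ l / 2) : ℂ) ∧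
        P (j l) (j l) = (Real.cos (θ l / 2) : ℂ) ∧
        P (i l) (j l) = (-(Real.sin (θ l / 2)) : ℂ) ∧
        P (j l) (i l) = (Real.sin (θ l / 2) : ℂ)) ∧
    (∀ a : ι, a ∉ Set.range i → a ∉ Set.range j → P a a = 1) ∧
    (∀ a b : ι, a ≠ b →
      (∀ l : Fin m, ¬((a = i l ∨ a = j l) ∧ (b = i l ∨ b = j l))) → P a b = 0) := by
  have hi : Function.Injective i := hinj.comp Sum.inl_injective
  have hj : Function.Injective j := hinj.comp Sum.inr_injective
  have hij : ∀ k l, i k ≠ j l := fun k l h => Sum.inl_ne_inr (hinj (a₁ := .inl k) (a₂ := .inr l) h)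
  have hdisj : ∀ k l, k ≠ l → ∀ a, a = i k ∨ a = j k → a ≠ i l ∧ a ≠ j l := by
    rintro k l hkl a (rfl | rfl)
    · exact ⟨hi.ne hkl, hij k l⟩
    · exact ⟨(hij l k).symm, hj.ne hkl⟩
  have hmem : ∀ l a b, a = i l ∨ a = j l → P a b = Rplus (i l) (j l) (θ l) a b :=
    fun l a b ha => hP ▸ list_prod_Rplus_apply_of_mem i j θ hdisj (List.nodup_finRange m)
      (List.mem_finRange l) ha b
  have hone : ∀ a b, (∀ l, a ≠ i l ∧ a ≠ j l) → P a b = (1 : Matrix ι ι ℂ) a b :=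
    fun a b h => hP ▸ list_prod_Rplus_apply_of_ne i j θ _ (fun l _ => h l) b
  refine ⟨fun l => ?_, fun a hai haj => ?_, fun a b hab h => ?_⟩
  · rw [hmem l (i l) _ (.inl rfl), hmem l (j l) _ (.inr rfl), hmem l (i l) _ (.inl rfl),
      hmem l (j l) _ (.inr rfl)]
    simp [Rplus, (hij l l).symm]
  · rw [hone a a fun l => ⟨fun h => hai ⟨l, h.symm⟩, fun h => haj ⟨l, h.symm⟩⟩,
      Matrix.one_apply_eq]
  · by_cases ha : ∃ l, a = i l ∨ a = j l
    · obtain ⟨l, hl⟩ := ha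
      have hb := not_or.1 fun hb => h l ⟨hl, hb⟩
      rw [hmem l a b hl, Rplus_apply_eq_zero _ hl hb.1 hb.2]
    · rw [hone a b fun l => not_or.1 fun hl => ha ⟨l, hl⟩, Matrix.one_apply_ne hab]
end

section
/- For every m : ℕ and θ : ℝ, the block-diagonal matrix Matrix.blockDiagonal (fun _ : Fin m => Ry(θ)) : Matrix (Fin 2 × Fin m) (Fin 2 × Fin m) ℂ (the additive-model image of the single-qubit gate 𝟙_m ⊗ Ry(θ)) equals the product ∏ l : Fin m, R⁺((0, l), (1, l), θ) of m two-level rotations on the disjoint index pairs ((0,l), (1,l)). -/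
open Matrix

noncomputable def Ry (θ : ℝ) : Matrix (Fin 2) (Fin 2) ℂ :=
  !![(Real.cos (θ / 2) : ℂ), (-(Real.sin (θ / 2)) : ℂ);
     (Real.sin (θ / 2) : ℂ), (Real.cos (θ / 2) : ℂ)]

/-- A two-level rotation inside the `l`-th block is block diagonal, with `Ry θ` in block `l` and
the identity in all other blocks. -/
theorem Rplus_eq_blockDiagonal_mulSingle {κ : Type*} [DecidableEq κ] (l : κ) (θ : ℝ) :
    Rplus ((0 : Fin 2), l) ((1 : Fin 2), l) θ =
      Matrix.blockDiagonal (Pi.mulSingle l (Ry θ)) := by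
  ext ⟨a, k⟩ ⟨b, k'⟩
  by_cases hk : k = l
  · subst hk
    by_cases hk' : k' = k
    · subst hk'
      fin_cases a <;> fin_cases b <;> simp [Rplus, Ry, Matrix.blockDiagonal_apply]
    · fin_cases a <;> simp [Rplus, Matrix.blockDiagonal_apply, hk', Ne.symm hk']
  · by_cases hk' : k = k' <;>
      simp [Rplus, Matrix.blockDiagonal_apply, hk, hk', Pi.mulSingle_apply]
    subst hk'
    simp [hk, Matrix.one_apply]

theorem List.Nodup.prod_map_mulSingle_apply {κ M : Type*} [DecidableEq κ] [Monoid M]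
    {L : List κ} (hL : L.Nodup) (x : M) (k : κ) :
    (L.map fun l => (Pi.mulSingle l x : κ → M) k).prod = if k ∈ L then x else 1 := by
  induction L with
  | nil => simp
  | cons l L ih =>
    rw [List.nodup_cons] at hL
    rw [List.map_cons, List.prod_cons, ih hL.2, Pi.mulSingle_apply]
    by_cases hk : k = l
    · subst hk
      simp [hL.1]
    · simp [hk]

/-- The additive-model image of the single-qubit gate 𝟙ₘ ⊗ Ry(θ), i.e. the block-diagonal
matrix with m diagonal blocks Ry(θ), equals the product of m two-level rotations on the
disjoint index pairs ((0,l), (1,l)). -/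
theorem blockDiagonal_Ry_eq_prod_Rplus (m : ℕ) (θ : ℝ) :
    Matrix.blockDiagonal (fun _ : Fin m => Ry θ) =
      ((List.finRange m).map
        (fun l => Rplus ((0 : Fin 2), l) ((1 : Fin 2), l) θ)).prod := by
  have hprod := map_list_prod (Matrix.blockDiagonalRingHom (Fin 2) (Fin m) ℂ)
    ((List.finRange m).map fun l => (Pi.mulSingle l (Ry θ) : Fin m → Matrix (Fin 2) (Fin 2) ℂ))
  rw [List.map_map] at hprod
  simp only [Rplus_eq_blockDiagonal_mulSingle]
  refine Eq.trans (congrArg Matrix.blockDiagonal (funext fun k => ?_)) hprod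
  rw [Pi.list_prod_apply, List.map_map]
  refine Eq.symm (((List.nodup_finRange m).prod_map_mulSingle_apply (Ry θ) k).trans ?_)
  simp
end

section
/- (Universality of the additive gate set.) For every n : ℕ and every unitary matrix U ∈ Matrix.unitaryGroup (Fin n) ℂ, there exist φ : ℝ and a list L of matrices in Matrix (Fin n) (Fin n) ℂ, each element of which is of one of the three forms: a two-level rotation R⁺(i, j, θ) with i ≠ j, a one-level phase P⁺(i, θ), or the permutation matrix Pσ of a transposition σ = Equiv.swap i j, such that (U : Matrix (Fin n) (Fin n) ℂ) = Complex.exp (φ * Complex.I) • L.prod. -/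
open Matrix

/-- The additive gates: two-level rotations, one-level phases and transposition matrices. -/
def additiveGates (ι : Type*) [DecidableEq ι] : Set (Matrix ι ι ℂ) :=
  {M | (∃ (i j : ι) (θ : ℝ), i ≠ j ∧ M = Rplus i j θ) ∨
    (∃ (i : ι) (θ : ℝ), M = Pplus i θ) ∨
    (∃ i j : ι, M = permMat (Equiv.swap i j))}

section

variable {ι : Type*} [DecidableEq ι]

lemma conjTranspose_Rplus (i j : ι) (θ : ℝ) :
    (Rplus i j θ)ᴴ = Rplus i j (-θ) := by
  have h (x : ℝ) : star (x : ℂ) = x := Complex.conj_ofReal x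
  ext a b
  simp only [Rplus, Matrix.conjTranspose_apply, Matrix.of_apply, neg_div, Real.cos_neg,
    Real.sin_neg, Complex.ofReal_neg, apply_ite star, star_neg, star_zero, star_one, h]
  grind

lemma conjTranspose_Pplus (i : ι) (θ : ℝ) : (Pplus i θ)ᴴ = Pplus i (-θ) := by
  rw [Pplus, Pplus, Matrix.diagonal_conjTranspose]
  congr 1
  ext a
  by_cases h : a = i <;> simp [h, ← Complex.exp_conj]

lemma conjTranspose_permMat_swap (i j : ι) :
    (permMat (Equiv.swap i j) : Matrix ι ι ℂ)ᴴ = permMat (Equiv.swap i j) := by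
  ext a b
  simp only [permMat, Matrix.conjTranspose_apply, Matrix.of_apply, ← Equiv.symm_apply_eq,
    Equiv.symm_swap, @eq_comm _ _ a]
  split_ifs <;> simp

lemma conjTranspose_mem_additiveGates {g : Matrix ι ι ℂ}
    (hg : g ∈ additiveGates ι) : gᴴ ∈ additiveGates ι := by
  rcases hg with ⟨i, j, θ, hij, rfl⟩ | ⟨i, θ, rfl⟩ | ⟨i, j, rfl⟩
  · exact .inl ⟨i, j, -θ, hij, conjTranspose_Rplus i j θ⟩
  · exact .inr (.inl ⟨i, -θ, conjTranspose_Pplus i θ⟩)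
  · exact .inr (.inr ⟨i, j, conjTranspose_permMat_swap i j⟩)

variable [Fintype ι]

lemma Rplus_mul_apply {i j : ι} (hij : i ≠ j) (θ : ℝ) (M : Matrix ι ι ℂ) (a b : ι) :
    (Rplus i j θ * M) a b =
      if a = i then (Real.cos (θ / 2) : ℂ) * M i b - (Real.sin (θ / 2) : ℂ) * M j b
      else if a = j then (Real.sin (θ / 2) : ℂ) * M i b + (Real.cos (θ / 2) : ℂ) * M j b
      else M a b := by
  have key (c d : ℂ) : ∑ x, (if x = i then c else if x = j then d else 0) * M x b
      = c * M i b + d * M j b := by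
    rw [← Finset.sum_subset (Finset.subset_univ {i, j}), Finset.sum_pair hij]
    · simp [hij.symm]
    · intro x _ hx
      simp only [Finset.mem_insert, Finset.mem_singleton, not_or] at hx
      simp [hx.1, hx.2]
  simp only [Matrix.mul_apply, Rplus, Matrix.of_apply]
  split_ifs with hi hj
  · rw [key]; ring
  · rw [key]
  · simp

lemma Pplus_mul_apply (i : ι) (θ : ℝ) (M : Matrix ι ι ℂ) (a b : ι) :
    (Pplus i θ * M) a b =
      (if a = i then Complex.exp ((θ : ℂ) * Complex.I) else 1) * M a b := by
  simp [Pplus, Matrix.diagonal_mul]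

lemma permMat_mul_apply (σ : Equiv.Perm ι) (M : Matrix ι ι ℂ) (a b : ι) :
    (permMat σ * M) a b = M (σ.symm a) b := by
  simp [permMat, Matrix.mul_apply, ← Equiv.symm_apply_eq]

lemma Rplus_neg_mul {i j : ι} (hij : i ≠ j) (θ : ℝ) : Rplus i j (-θ) * Rplus i j θ = 1 := by
  have h : (Real.cos (θ / 2) : ℂ) ^ 2 + (Real.sin (θ / 2) : ℂ) ^ 2 = 1 := by
    exact_mod_cast Real.cos_sq_add_sin_sq (θ / 2)
  ext a b
  rw [Rplus_mul_apply hij]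
  simp only [Rplus, Matrix.of_apply, neg_div, Real.cos_neg, Real.sin_neg, Complex.ofReal_neg,
    Matrix.one_apply]
  grind

lemma Pplus_neg_mul (i : ι) (θ : ℝ) : Pplus i (-θ) * Pplus i θ = 1 := by
  ext a b
  rw [Pplus_mul_apply]
  by_cases hab : a = b
  · subst hab
    by_cases hi : a = i <;> simp [Pplus, hi, ← Complex.exp_add]
  · simp [Pplus, hab]

lemma permMat_swap_mul_self (i j : ι) :
    permMat (Equiv.swap i j) * permMat (Equiv.swap i j) = (1 : Matrix ι ι ℂ) := by
  ext a b
  rw [permMat_mul_apply]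
  simp [permMat, Matrix.one_apply]

lemma conjTranspose_mul_self_of_mem_additiveGates {g : Matrix ι ι ℂ}
    (hg : g ∈ additiveGates ι) : gᴴ * g = 1 := by
  rcases hg with ⟨i, j, θ, hij, rfl⟩ | ⟨i, θ, rfl⟩ | ⟨i, j, rfl⟩
  · rw [conjTranspose_Rplus, Rplus_neg_mul hij]
  · rw [conjTranspose_Pplus, Pplus_neg_mul]
  · rw [conjTranspose_permMat_swap, permMat_swap_mul_self]

lemma closure_additiveGates_le_unitaryGroup :
    Submonoid.closure (additiveGates ι) ≤ Matrix.unitaryGroup ι ℂ := by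
  rw [Submonoid.closure_le]
  intro g hg
  exact Matrix.mem_unitaryGroup_iff'.2 (conjTranspose_mul_self_of_mem_additiveGates hg)

lemma mem_closure_additiveGates_of_mul_mem {g : Matrix ι ι ℂ}
    (hg : g ∈ Submonoid.closure (additiveGates ι)) {U : Matrix ι ι ℂ}
    (hU : g * U ∈ Submonoid.closure (additiveGates ι)) :
    U ∈ Submonoid.closure (additiveGates ι) := by
  induction hg using Submonoid.closure_induction generalizing U with
  | mem g hg =>
    have := mul_mem (Submonoid.subset_closure (conjTranspose_mem_additiveGates hg)) hU
    rwa [← mul_assoc, conjTranspose_mul_self_of_mem_additiveGates hg, one_mul] at this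
  | one => simpa using hU
  | mul x y _ _ hx hy =>
    rw [mul_assoc] at hU
    exact hy (hx hU)

lemma exists_rotation_angle (x y : ℂ) : ∃ α β θ : ℝ,
    (Real.sin (θ / 2) : ℂ) * (Complex.exp (α * Complex.I) * x) +
      (Real.cos (θ / 2) : ℂ) * (Complex.exp (β * Complex.I) * y) = 0 := by
  have phase (z : ℂ) : Complex.exp ((-z.arg : ℝ) * Complex.I) * z = ‖z‖ := by
    conv_lhs => rw [← Complex.norm_mul_exp_arg_mul_I z]
    rw [mul_left_comm, ← Complex.exp_add]
    simp
  set z : ℂ := ⟨‖x‖, ‖y‖⟩ with hz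
  refine ⟨-x.arg, -y.arg, -(2 * z.arg), ?_⟩
  rw [phase, phase]
  have h1 : ‖z‖ * Real.cos z.arg = ‖x‖ := Complex.norm_mul_cos_arg z
  have h2 : ‖z‖ * Real.sin z.arg = ‖y‖ := Complex.norm_mul_sin_arg z
  have h3 : -(2 * z.arg) / 2 = -z.arg := by ring
  rw [h3, Real.cos_neg, Real.sin_neg, ← h1, ← h2]
  push_cast
  ring

/-- Two coordinates outside `S` can be rotated so as to clear one entry of column `k`, leaving all
other rows and the columns in `S` untouched. -/
lemma exists_clear_entry (M : Matrix ι ι ℂ) {k i : ι} (hki : k ≠ i) {S : Set ι}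
    (hS : ∀ b ∈ S, M k b = 0 ∧ M i b = 0) :
    ∃ g ∈ Submonoid.closure (additiveGates ι), (g * M) i k = 0 ∧
      (∀ a, a ≠ k → a ≠ i → ∀ b, (g * M) a b = M a b) ∧
      ∀ b ∈ S, ∀ a, (g * M) a b = M a b := by
  obtain ⟨α, β, θ, h⟩ := exists_rotation_angle (M k k) (M i k)
  refine ⟨Rplus k i θ * (Pplus k α * Pplus i β), mul_mem (Submonoid.subset_closure
    (.inl ⟨k, i, θ, hki, rfl⟩)) (mul_mem (Submonoid.subset_closure (.inr (.inl ⟨k, α, rfl⟩)))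
    (Submonoid.subset_closure (.inr (.inl ⟨i, β, rfl⟩)))), ?_, ?_, ?_⟩
  · simpa only [mul_assoc, Rplus_mul_apply hki, Pplus_mul_apply, hki, hki.symm, if_true, if_false,
      one_mul] using h
  · intro a hak hai b
    simp [mul_assoc, Rplus_mul_apply hki, Pplus_mul_apply, hak, hai]
  · intro b hb a
    simp only [mul_assoc, Rplus_mul_apply hki, Pplus_mul_apply, hS b hb]
    split_ifs <;> simp_all

lemma exists_clear_column (M : Matrix ι ι ℂ) {S : Set ι}
    (hS : ∀ b ∈ S, ∀ a, M a b = (1 : Matrix ι ι ℂ) a b) {k : ι} (hk : k ∉ S) (T : Finset ι)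
    (hkT : k ∉ T) (hTS : ∀ a ∈ T, a ∉ S) :
    ∃ g ∈ Submonoid.closure (additiveGates ι), (∀ a ∈ T, (g * M) a k = 0) ∧
      ∀ b ∈ S, ∀ a, (g * M) a b = (1 : Matrix ι ι ℂ) a b := by
  induction T using Finset.induction_on with
  | empty => exact ⟨1, one_mem _, by simp, by simpa using hS⟩
  | insert i T hiT ih =>
    simp only [Finset.mem_insert, not_or, forall_eq_or_imp] at hkT hTS
    obtain ⟨g, hg, hgT, hgS⟩ := ih hkT.2 hTS.2
    obtain ⟨g', hg', h0, hrow, hcol⟩ := exists_clear_entry (g * M) hkT.1 (S := S) fun b hb =>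
      ⟨by rw [hgS b hb, Matrix.one_apply_ne]; rintro rfl; exact hk hb,
        by rw [hgS b hb, Matrix.one_apply_ne]; rintro rfl; exact hTS.1 hb⟩
    refine ⟨g' * g, mul_mem hg' hg, ?_, fun b hb a => ?_⟩
    · simp only [Finset.mem_insert, forall_eq_or_imp, mul_assoc, h0, true_and]
      intro a ha
      rw [hrow a (by rintro rfl; exact hkT.2 ha) (by rintro rfl; exact hiT ha), hgT a ha]
    · rw [mul_assoc, hcol b hb, hgS b hb]

lemma exists_fix_column {U : Matrix ι ι ℂ} (hU : U ∈ Matrix.unitaryGroup ι ℂ) {S : Finset ι}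
    (hS : ∀ b ∈ S, ∀ a, U a b = (1 : Matrix ι ι ℂ) a b) {k : ι} (hk : k ∉ S) :
    ∃ g ∈ Submonoid.closure (additiveGates ι),
      ∀ b ∈ insert k S, ∀ a, (g * U) a b = (1 : Matrix ι ι ℂ) a b := by
  obtain ⟨g, hg, hgT, hgS⟩ := exists_clear_column U (S := S) hS (k := k) hk (insert k S)ᶜ
    (by simp) (by simp +contextual)
  set V := g * U with hV
  have hVu : Vᴴ * V = 1 := Matrix.mem_unitaryGroup_iff'.1
    (mul_mem (closure_additiveGates_le_unitaryGroup hg) hU)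
  have hcol (a : ι) (ha : a ≠ k) : V a k = 0 := by
    by_cases haS : a ∈ S
    · have := congrFun₂ hVu a k
      simpa [Matrix.mul_apply, hgS a haS, Matrix.one_apply, ha] using this
    · exact hgT a (by simp [ha, haS])
  have hnorm : ‖V k k‖ = 1 := by
    have := congrFun₂ hVu k k
    rw [Matrix.mul_apply, Finset.sum_eq_single k (fun a _ ha => by simp [hcol a ha]) (by simp),
      Matrix.conjTranspose_apply, Matrix.one_apply_eq, Complex.star_def, Complex.conj_mul'] at this
    have h2 : ‖V k k‖ ^ 2 = 1 := by exact_mod_cast this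
    exact (pow_eq_one_iff_of_nonneg (norm_nonneg _) two_ne_zero).1 h2
  refine ⟨Pplus k (-(V k k).arg) * g, mul_mem (Submonoid.subset_closure
    (.inr (.inl ⟨k, _, rfl⟩))) hg, ?_⟩
  simp only [Finset.mem_insert, forall_eq_or_imp, mul_assoc, ← hV, Pplus_mul_apply]
  refine ⟨fun a => ?_, fun b hb a => ?_⟩
  · by_cases ha : a = k
    · subst ha
      have h := Complex.norm_mul_exp_arg_mul_I (V a a)
      rw [hnorm, Complex.ofReal_one, one_mul] at h
      rw [if_pos rfl, Matrix.one_apply_eq]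
      nth_rw 2 [← h]
      rw [← Complex.exp_add]
      simp
    · rw [hcol a ha, mul_zero, Matrix.one_apply_ne ha]
  · rw [hgS b hb]
    by_cases ha : a = k
    · rw [Matrix.one_apply_ne (by rintro rfl; exact hk (ha ▸ hb)), mul_zero]
    · simp [ha]

theorem unitaryGroup_le_closure_additiveGates :
    Matrix.unitaryGroup ι ℂ ≤ Submonoid.closure (additiveGates ι) := by
  suffices h : ∀ (T : Finset ι) (U : Matrix ι ι ℂ), U ∈ Matrix.unitaryGroup ι ℂ →
      (∀ b ∈ Tᶜ, ∀ a, U a b = (1 : Matrix ι ι ℂ) a b) →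
      U ∈ Submonoid.closure (additiveGates ι) from
    fun U hU => h Finset.univ U hU (by simp)
  intro T
  induction T using Finset.induction_on with
  | empty =>
    intro U _ h
    obtain rfl : U = 1 := by ext a b; exact h b (by simp) a
    exact one_mem _
  | insert k T hk ih =>
    intro U hU h
    obtain ⟨g, hg, hgU⟩ := exists_fix_column hU h (k := k) (by simp)
    refine mem_closure_additiveGates_of_mul_mem hg
      (ih _ (mul_mem (closure_additiveGates_le_unitaryGroup hg) hU) fun b hb => hgU b ?_)
    simp only [Finset.mem_insert, Finset.mem_compl] at hb ⊢
    tauto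

end

/-- Universality of the additive gate set: every unitary matrix is, up to global phase,
a product of two-level rotations, one-level phases and transposition matrices. -/
theorem additive_gate_set_universal (n : ℕ) (U : Matrix (Fin n) (Fin n) ℂ)
    (hU : U ∈ Matrix.unitaryGroup (Fin n) ℂ) :
    ∃ (φ : ℝ) (L : List (Matrix (Fin n) (Fin n) ℂ)),
      (∀ M ∈ L,
        (∃ (i j : Fin n) (θ : ℝ), i ≠ j ∧ M = Rplus i j θ) ∨
        (∃ (i : Fin n) (θ : ℝ), M = Pplus i θ) ∨
        (∃ i j : Fin n, M = permMat (Equiv.swap i j))) ∧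
      U = Complex.exp ((φ : ℂ) * Complex.I) • L.prod := by
  obtain ⟨L, hL, rfl⟩ :=
    Submonoid.exists_list_of_mem_closure (unitaryGroup_le_closure_additiveGates hU)
  exact ⟨0, L, hL, by simp⟩
end

section
/- (Stacked vertex factorization.) Let n k : ℕ with k < n, θ : ℝ, j : Fin n, S : Finset (Fin n) with j ∈ S and S.card = k + 1, and b₀ : Fin n → Bool. Let A := {b : Fin n → Bool | b j = false ∧ ∀ i ∉ S, b i = b₀ i} (so A has cardinality 2^k; A determines a stacked vertex of length 2^k satisfying the edge, parallel and dense constraints). For b : Fin n → Bool write b^j for the bitstring obtained from b by flipping coordinate j. Let V : Matrix (Fin n → Bool) (Fin n → Bool) ℂ be the matrix with, for each b ∈ A: V b b = V b^j b^j = cos(θ/2), V b b^j = −sin(θ/2), V b^j b = sin(θ/2); with V a a = 1 for every bitstring a such that a ∉ A and a^j ∉ A; and with all other entries 0. Then, setting T := Sᶜ (so T.card = n − k − 1 and j ∉ T), there exists c : Fin n → Bool with c i = false for all i ∈ S, such that V = Xc * CRy(T, j, θ) * Xc. In particular, if k + 1 = n then T = ∅ and V = CRy(∅, j, θ), an uncontrolled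 Ry(θ) rotation on coordinate j. -/
open Matrix

/-- Flip coordinate `j` of the bitstring `b`. -/
def flipBit {n : ℕ} (j : Fin n) (b : Fin n → Bool) : Fin n → Bool :=
  Function.update b j (!(b j))

/-- The permutation matrix of the involution `b ↦ fun i => xor (b i) (c i)`
(conjugation by X gates on the qubits where `c` is true). -/
def XMat {n : ℕ} (c : Fin n → Bool) : Matrix (Fin n → Bool) (Fin n → Bool) ℂ :=
  Matrix.of fun b b' => if b = (fun i => xor (b' i) (c i)) then 1 else 0

/-- The multi-controlled rotation CRy(T, j, θ): an Ry(θ) rotation on the target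
coordinate `j`, controlled on the qubits in `T` being set. -/
noncomputable def CRyMat {n : ℕ} (T : Finset (Fin n)) (j : Fin n) (θ : ℝ) :
    Matrix (Fin n → Bool) (Fin n → Bool) ℂ :=
  Matrix.of fun b b' =>
    if (∀ i, i ≠ j → b i = b' i) ∧ (∀ i ∈ T, b i = true) then
      (if b j = b' j then (Real.cos (θ / 2) : ℂ)
       else if b j = false then (-(Real.sin (θ / 2)) : ℂ)
       else (Real.sin (θ / 2) : ℂ))
    else if b = b' ∧ ∃ i ∈ T, b i = false then 1 else 0

/-- The matrix of the stacked vertex determined by the set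
`A = {b | b j = false ∧ ∀ i ∉ S, b i = b₀ i}`: for each `b ∈ A` it rotates the pair of
dimensions `(b, b^j)` by `θ`, and it is the identity on all dimensions `a` with
`a ∉ A` and `a^j ∉ A`. -/
noncomputable def Vmat {n : ℕ} (j : Fin n) (S : Finset (Fin n)) (b₀ : Fin n → Bool)
    (θ : ℝ) : Matrix (Fin n → Bool) (Fin n → Bool) ℂ :=
  Matrix.of fun b b' =>
    if b j = false ∧ (∀ i ∉ S, b i = b₀ i) then
      -- `b ∈ A`: row of the rotated pair with `V b b = cos(θ/2)`, `V b b^j = −sin(θ/2)`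
      (if b' = b then (Real.cos (θ / 2) : ℂ)
       else if b' = flipBit j b then (-(Real.sin (θ / 2)) : ℂ) else 0)
    else if (flipBit j b) j = false ∧ (∀ i ∉ S, (flipBit j b) i = b₀ i) then
      -- `b = a^j` with `a ∈ A`: row with `V b^j b^j = cos(θ/2)`, `V b^j b = sin(θ/2)`
      (if b' = b then (Real.cos (θ / 2) : ℂ)
       else if b' = flipBit j b then (Real.sin (θ / 2) : ℂ) else 0)
    else (if b' = b then 1 else 0)

theorem XMat_mul_mul_XMat_apply {n : ℕ} (c : Fin n → Bool)
    (M : Matrix (Fin n → Bool) (Fin n → Bool) ℂ) (b b' : Fin n → Bool) :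
    (XMat c * M * XMat c) b b' = M (fun i => xor (b i) (c i)) (fun i => xor (b' i) (c i)) := by
  have key (a x : Fin n → Bool) :
      (a = fun i => xor (x i) (c i)) ↔ x = fun i => xor (a i) (c i) := by
    constructor <;> rintro rfl <;> funext i <;> simp
  simp only [Matrix.mul_apply, XMat, Matrix.of_apply, ite_mul, one_mul, zero_mul, mul_ite,
    mul_one, mul_zero, Finset.sum_ite_eq', Finset.mem_univ, if_true]
  simp only [key b, Finset.sum_ite_eq', Finset.mem_univ, if_true]

theorem eq_flipBit_iff {n : ℕ} (j : Fin n) (b b' : Fin n → Bool) :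
    b' = flipBit j b ↔ (∀ i, i ≠ j → b i = b' i) ∧ b j ≠ b' j := by
  rw [flipBit, Function.eq_update_iff, Bool.eq_not, and_comm]
  simp only [eq_comm, ne_eq]

theorem eq_iff_agree_off {n : ℕ} (j : Fin n) (b b' : Fin n → Bool) :
    b' = b ↔ (∀ i, i ≠ j → b i = b' i) ∧ b j = b' j := by
  constructor
  · rintro rfl
    simp
  · rintro ⟨h, hj⟩
    funext i
    by_cases hi : i = j
    · rw [hi, hj]
    · exact (h i hi).symm

theorem flipBit_agree_iff {n : ℕ} {j : Fin n} {S : Finset (Fin n)} (hj : j ∈ S)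
    (b b₀ : Fin n → Bool) :
    (∀ i ∉ S, flipBit j b i = b₀ i) ↔ ∀ i ∉ S, b i = b₀ i := by
  refine forall₂_congr fun i hi => ?_
  rw [flipBit, Function.update_of_ne (ne_of_mem_of_not_mem hj hi).symm]

theorem Vmat_apply {n : ℕ} {j : Fin n} {S : Finset (Fin n)} (hj : j ∈ S)
    (b₀ : Fin n → Bool) (θ : ℝ) (b b' : Fin n → Bool) :
    Vmat j S b₀ θ b b' = CRyMat Sᶜ j θ
      (fun i => xor (b i) (if i ∈ S then false else !(b₀ i)))
      (fun i => xor (b' i) (if i ∈ S then false else !(b₀ i))) := by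
  have hT : (∀ i ∈ Sᶜ, xor (b i) (if i ∈ S then false else !(b₀ i)) = true) ↔
      ∀ i ∉ S, b i = b₀ i := by
    simp only [Finset.mem_compl]
    refine forall₂_congr fun i hi => ?_
    simp [hi]
  have hT' : (∃ i ∈ Sᶜ, xor (b i) (if i ∈ S then false else !(b₀ i)) = false) ↔
      ¬ ∀ i ∉ S, b i = b₀ i := by
    rw [← hT]
    push Not
    simp only [ne_eq, Bool.not_eq_true]
  have hb : ((fun i => xor (b i) (if i ∈ S then false else !(b₀ i))) =
      fun i => xor (b' i) (if i ∈ S then false else !(b₀ i))) ↔ b' = b := by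
    simp [funext_iff, eq_comm]
  have hf : flipBit j b j = !(b j) := by simp [flipBit]
  simp only [Vmat, CRyMat, Matrix.of_apply, hT, hT', hb, flipBit_agree_iff hj, hf,
    Bool.xor_left_inj, hj, if_true, Bool.xor_false, eq_flipBit_iff, eq_iff_agree_off j b b']
  clear hT hT' hb
  grind

/-- Stacked vertex factorization: a stacked vertex of length 2^k satisfying the edge,
parallel and dense constraints factorizes, up to conjugation by X gates on a subset of
the qubits outside `S`, as a multi-controlled rotation with control set `T = Sᶜ` and
target `j`. In particular, when `k + 1 = n`, it is an uncontrolled Ry(θ) rotation on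
coordinate `j`. -/
theorem stacked_vertex_factorization (n k : ℕ) (hk : k < n) (θ : ℝ) (j : Fin n)
    (S : Finset (Fin n)) (hj : j ∈ S) (hcard : S.card = k + 1) (b₀ : Fin n → Bool) :
    (∃ c : Fin n → Bool, (∀ i ∈ S, c i = false) ∧
      Vmat j S b₀ θ = XMat c * CRyMat Sᶜ j θ * XMat c) ∧
    (k + 1 = n → Vmat j S b₀ θ = CRyMat (∅ : Finset (Fin n)) j θ) := by
  have hV := Vmat_apply hj b₀ θ
  refine ⟨⟨fun i => if i ∈ S then false else !(b₀ i), fun i hi => by simp [hi], ?_⟩, ?_⟩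
  · ext b b'
    rw [XMat_mul_mul_XMat_apply, hV]
  · intro hn
    have hS : S = Finset.univ := by
      rw [← Finset.card_eq_iff_eq_univ, hcard, hn, Fintype.card_fin]
    subst hS
    ext b b'
    rw [hV]
    simp
end
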